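/- For each fixed b̃ with 0 ≤ b̃ < L, the limit function is strictly increasing in the inertia: if ε·L·ω0/(2·Δ2) ≤ M < M', then h(M, b̃) < h(M', b̃). -/

import Mathlib

/-- `c(M) := ω0·ε·L/(2M)`. -/
noncomputable def cFun (ω0 ε L M : ℝ) : ℝ := ω0 * ε * L / (2 * M)

/-- The limit function
`h(M, b̃) := (4M/ω0)·(Δ2 + Δ3 − c(M))²·(L − b̃) /
  (b̃·√Δ3 − √((Δ2 + Δ3 − c(M))·L² − (Δ2 − c(M))·b̃²))²`. -/
noncomputable def limitFun (ω0 Δ2 Δ3 ε L M b : ℝ) : ℝ :=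
  (4 * M / ω0) * (Δ2 + Δ3 - cFun ω0 ε L M) ^ 2 * (L - b) /
    (b * Real.sqrt Δ3 -
      Real.sqrt ((Δ2 + Δ3 - cFun ω0 ε L M) * L ^ 2 - (Δ2 - cFun ω0 ε L M) * b ^ 2)) ^ 2

theorem cFun_le_of_le {ω0 Δ2 ε L M : ℝ} (hΔ2 : 0 < Δ2) (hM0 : 0 < M)
    (hM : ε * L * ω0 / (2 * Δ2) ≤ M) : cFun ω0 ε L M ≤ Δ2 := by
  unfold cFun
  rw [div_le_iff₀ (by positivity)] at hM ⊢
  linarith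

theorem cFun_antitone {ω0 ε L M M' : ℝ} (hω0 : 0 < ω0) (hε : 0 < ε) (hL : 0 < L)
    (hM : 0 < M) (hMM' : M ≤ M') : cFun ω0 ε L M' ≤ cFun ω0 ε L M := by
  unfold cFun
  gcongr

/-- Rationalising the denominator of the limit function, since
`R² - b²·Δ3 = (Δ2 + Δ3 - c)·(L² - b²)` for the square root `R` occurring in it. -/
theorem limitFun_eq_rationalized {ω0 Δ2 Δ3 ε L b M : ℝ} (hΔ3 : 0 < Δ3)
    (hb0 : 0 ≤ b) (hbL : b < L) (hc : cFun ω0 ε L M ≤ Δ2) :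
    limitFun ω0 Δ2 Δ3 ε L M b =
      (4 * M / ω0) * (L - b) / (L ^ 2 - b ^ 2) ^ 2 *
        (b * Real.sqrt Δ3 +
          Real.sqrt (Δ3 * L ^ 2 + (Δ2 - cFun ω0 ε L M) * (L ^ 2 - b ^ 2))) ^ 2 := by
  unfold limitFun
  set x := Δ2 - cFun ω0 ε L M with hx
  have hx0 : 0 ≤ x := sub_nonneg.mpr hc
  have hD : 0 < L ^ 2 - b ^ 2 := by nlinarith
  rw [show Δ2 + Δ3 - cFun ω0 ε L M = x + Δ3 by rw [hx]; ring,
    show (x + Δ3) * L ^ 2 - x * b ^ 2 = Δ3 * L ^ 2 + x * (L ^ 2 - b ^ 2) by ring]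
  have hR : Real.sqrt (Δ3 * L ^ 2 + x * (L ^ 2 - b ^ 2)) ^ 2 =
      Δ3 * L ^ 2 + x * (L ^ 2 - b ^ 2) := Real.sq_sqrt (by positivity)
  have hs : Real.sqrt Δ3 ^ 2 = Δ3 := Real.sq_sqrt hΔ3.le
  set R := Real.sqrt (Δ3 * L ^ 2 + x * (L ^ 2 - b ^ 2))
  set s := Real.sqrt Δ3
  have key : (b * s - R) * (b * s + R) = -((x + Δ3) * (L ^ 2 - b ^ 2)) := by
    linear_combination b ^ 2 * hs - hR
  have hne : b * s - R ≠ 0 := by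
    intro h
    rw [h, zero_mul] at key
    have : 0 < (x + Δ3) * (L ^ 2 - b ^ 2) := by positivity
    linarith
  have hsq : (x + Δ3) ^ 2 * (L ^ 2 - b ^ 2) ^ 2 = (b * s - R) ^ 2 * (b * s + R) ^ 2 := by
    rw [← mul_pow, ← mul_pow, key, neg_sq]
  generalize 4 * M / ω0 = k
  rw [div_eq_iff (pow_ne_zero 2 hne), div_mul_eq_mul_div, div_mul_eq_mul_div,
    eq_div_iff (pow_ne_zero 2 hD.ne')]
  linear_combination k * (L - b) * hsq

/-- For each fixed `b̃` with `0 ≤ b̃ < L`, the limit function is strictly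
increasing in the inertia: if `ε·L·ω0/(2·Δ2) ≤ M < M'`, then `h(M, b̃) < h(M', b̃)`.
(Here the governor response delay satisfies `ε > 0`.) -/
theorem limitFun_strictMono_in_inertia (ω0 Δ2 Δ3 ε L : ℝ)
    (hω0 : 0 < ω0) (hΔ2 : 0 < Δ2) (hΔ3 : 0 < Δ3) (hε : 0 < ε) (hL : 0 < L)
    (b : ℝ) (hb0 : 0 ≤ b) (hbL : b < L)
    (M M' : ℝ) (hM : ε * L * ω0 / (2 * Δ2) ≤ M) (hMM' : M < M') :
    limitFun ω0 Δ2 Δ3 ε L M b < limitFun ω0 Δ2 Δ3 ε L M' b := by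
  have hM0 : 0 < M := lt_of_lt_of_le (by positivity) hM
  have hc := cFun_le_of_le hΔ2 hM0 hM
  have hcc := cFun_antitone hω0 hε hL hM0 hMM'.le
  rw [limitFun_eq_rationalized hΔ3 hb0 hbL hc,
    limitFun_eq_rationalized hΔ3 hb0 hbL (hcc.trans hc)]
  have hD : 0 < L ^ 2 - b ^ 2 := by nlinarith
  have hLb : 0 < L - b := sub_pos.mpr hbL
  have hx0 : 0 ≤ Δ2 - cFun ω0 ε L M := sub_nonneg.mpr hc
  refine mul_lt_mul (by gcongr) (by gcongr) (by positivity) ?_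
  have hM'0 : 0 < M' := hM0.trans hMM'
  positivity
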